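/- Let (M⁻,M⁺) over Σ_M and (N⁻,N⁺) over Σ_N be symbolic matrix bisystems satisfying FPCC that are properly strong shift equivalent in 1-step via specifications φ : Σ_M → C·D and ψ : Σ_N → D·C (and matrices P_l, Q_l, X_l, Y_l). For any word x₁x₂ ∈ B₂(Λ_M) of length two in the presenting subshift Λ_M, writing φ(x_i) = c_i d_i with c_i ∈ C, d_i ∈ D (i = 1, 2), there exists a unique symbol y₀ ∈ Σ_N such that ψ(y₀) = d₁c₂. -/

import Mathlib

/-- Product of two symbolic matrices: the entries of the product of a symbolic matrix
over `C` and a symbolic matrix over `D` are formal sums (multisets) of two-letter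
words in `C·D`. -/
def symMul {I J K C D : Type} [Fintype J]
    (A : I → J → Multiset C) (B : J → K → Multiset D) : I → K → Multiset (C × D) :=
  fun i k => ∑ j : J, (A i j).bind fun a => (B j k).map fun b => (a, b)
/-- The underlying data of a symbolic matrix bisystem: sequences of `m l × m (l+1)`
symbolic matrices (entries are formal sums, i.e. multisets, of symbols). -/
structure SMBData (Sm Sp : Type) where
  m : ℕ → ℕ
  Mm : ∀ l, Fin (m l) → Fin (m (l + 1)) → Multiset Sm
  Mp : ∀ l, Fin (m l) → Fin (m (l + 1)) → Multiset Sp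

/-- The axioms making the data `M` a symbolic matrix bisystem: nonzero rows and
columns, no repeated symbol in an entry, no symbol repeated across the rows of a
column (right/left resolving), and the κ-commutation relation
`M⁻_{l,l+1} M⁺_{l+1,l+2} ≃_κ M⁺_{l,l+1} M⁻_{l+1,l+2}`. -/
structure IsSMB {Sm Sp : Type} (M : SMBData Sm Sp) : Prop where
  mpos : ∀ l, 0 < M.m l
  row_m : ∀ l i, ∃ j, M.Mm l i j ≠ 0
  col_m : ∀ l j, ∃ i, M.Mm l i j ≠ 0
  row_p : ∀ l i, ∃ j, M.Mp l i j ≠ 0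
  col_p : ∀ l j, ∃ i, M.Mp l i j ≠ 0
  nodup_m : ∀ l i j, (M.Mm l i j).Nodup
  nodup_p : ∀ l i j, (M.Mp l i j).Nodup
  res_m : ∀ l j i i' a, a ∈ M.Mm l i j → a ∈ M.Mm l i' j → i = i'
  res_p : ∀ l j i i' a, a ∈ M.Mp l i j → a ∈ M.Mp l i' j → i = i'
  commute : ∀ l i j,
    (symMul (M.Mm l) (M.Mp (l + 1)) i j).map Prod.swap = symMul (M.Mp l) (M.Mm (l + 1)) i j

/-- Entries of the product of `k` consecutive symbolic matrices starting at level `n`: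
formal sums of words of length `k`. -/
def prodFrom {S : Type} {m : ℕ → ℕ}
    (M : ∀ l, Fin (m l) → Fin (m (l + 1)) → Multiset S) (n : ℕ) :
    (k : ℕ) → Fin (m n) → Fin (m (n + k)) → Multiset (List S)
  | 0, i, j => if i = j then {[]} else 0
  | k + 1, i, j =>
      ∑ p : Fin (m (n + k)),
        (prodFrom M n k i p).bind fun w => (M (n + k) p j).map fun a => w ++ [a]

/-- FPCC for a symbolic matrix bisystem over a common alphabet: it is standard
(`m 0 = 1`) and for every `l ≥ 1` the words appearing in the `(1,j)` entry of
`M⁻_{0,1}⋯M⁻_{l-1,l}` are exactly the reversed words appearing in the `(1,j)` entry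
of `M⁺_{0,1}⋯M⁺_{l-1,l}`. -/
def SMBData.FPCC {S : Type} (M : SMBData S S) : Prop :=
  M.m 0 = 1 ∧
  ∀ l : ℕ, 1 ≤ l → ∀ (i : Fin (M.m 0)) (j : Fin (M.m (0 + l))) (w : List S),
    w ∈ prodFrom M.Mm 0 l i j ↔ w.reverse ∈ prodFrom M.Mp 0 l i j

/-- The set of nonempty admissible words of the presenting subshift of a symbolic
matrix bisystem: the words appearing as entries of products
`M⁺_{l,l+1} M⁺_{l+1,l+2} ⋯ M⁺_{l+k-1,l+k}`. -/
def smbWords {S : Type} (M : SMBData S S) : Set (List S) :=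
  { w | w ≠ [] ∧ ∃ (n k : ℕ) (i : Fin (M.m n)) (j : Fin (M.m (n + k))),
      w ∈ prodFrom M.Mp n k i j }
/-- The data of a properly strong shift equivalence in 1-step between two symbolic
matrix bisystems `M` (over `Σ_M`) and `N` (over `Σ_N`), with alphabets `C, D`,
specifications `φ : Σ_M → C·D`, `ψ : Σ_N → D·C`, and matrices `P_l` over `C`, `Q_l`
over `D`, `X_l` over `D` and `Y_l` over `C` (the parity-dependent families `X, Y`
are recorded as `Xe l = X_{2l}`, `Xo l = X_{2l+1}`, `Ye l = Y_{2l}`, `Yo l = Y_{2l+1}`),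
subject to the defining specified equivalences. -/
structure PSSE1Data (C D : Type) {SM SN : Type} (M : SMBData SM SM) (N : SMBData SN SN) where
  φ : SM → C × D
  ψ : SN → D × C
  φ_inj : Function.Injective φ
  ψ_inj : Function.Injective ψ
  c : ℕ → ℕ
  d : ℕ → ℕ
  hc : ∀ l, c (2 * l) = M.m l
  hd : ∀ l, d (2 * l) = N.m l
  P : ∀ l, Fin (c l) → Fin (d (l + 1)) → Multiset C
  Q : ∀ l, Fin (d l) → Fin (c (l + 1)) → Multiset D
  Xe : ∀ l, Fin (c (2 * l)) → Fin (c (2 * l + 1)) → Multiset D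
  Xo : ∀ l, Fin (d (2 * l + 1)) → Fin (d (2 * l + 2)) → Multiset D
  Ye : ∀ l, Fin (d (2 * l)) → Fin (d (2 * l + 1)) → Multiset C
  Yo : ∀ l, Fin (c (2 * l + 1)) → Fin (c (2 * l + 2)) → Multiset C
  hMp : ∀ l i j, (M.Mp l i j).map φ =
    symMul (P (2 * l)) (Q (2 * l + 1)) (Fin.cast (hc l).symm i) (Fin.cast (hc (l + 1)).symm j)
  hNp : ∀ l i j, (N.Mp l i j).map ψ =
    symMul (Q (2 * l)) (P (2 * l + 1)) (Fin.cast (hd l).symm i) (Fin.cast (hd (l + 1)).symm j)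
  hMm : ∀ l i j, (M.Mm l i j).map (Prod.swap ∘ φ) =
    symMul (Xe l) (Yo l) (Fin.cast (hc l).symm i) (Fin.cast (hc (l + 1)).symm j)
  hNm : ∀ l i j, (N.Mm l i j).map (Prod.swap ∘ ψ) =
    symMul (Ye l) (Xo l) (Fin.cast (hd l).symm i) (Fin.cast (hd (l + 1)).symm j)
  hYP : ∀ l i j, (symMul (Yo l) (P (2 * l + 2)) i j).map Prod.swap =
    symMul (P (2 * l + 1)) (Ye (l + 1)) i j
  hXQ : ∀ l i j, (symMul (Xo l) (Q (2 * l + 2)) i j).map Prod.swap =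
    symMul (Q (2 * l + 1)) (Xe (l + 1)) i j
  hXP : ∀ l i j, (symMul (Xe l) (P (2 * l + 1)) i j).map Prod.swap =
    symMul (P (2 * l)) (Xo l) i j
  hYQ : ∀ l i j, (symMul (Ye l) (Q (2 * l + 1)) i j).map Prod.swap =
    symMul (Q (2 * l)) (Yo l) i j

/-- Properly strong shift equivalence in 1-step. -/
def PSSE1 {SM SN : Type} (M : SMBData SM SM) (N : SMBData SN SN) : Prop :=
  ∃ C D : Type, Nonempty (PSSE1Data C D M N)

theorem mem_symMul {I J K C D : Type} [Fintype J]
    {A : I → J → Multiset C} {B : J → K → Multiset D} {i : I} {k : K} {a : C} {b : D} :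
    (a, b) ∈ symMul A B i k ↔ ∃ j, a ∈ A i j ∧ b ∈ B j k := by
  simp [symMul, Multiset.mem_sum]

theorem mem_symMul_of_map_swap {I J J' K C D : Type} [Fintype J] [Fintype J']
    {A : I → J → Multiset C} {B : J → K → Multiset D}
    {B' : I → J' → Multiset D} {A' : J' → K → Multiset C} {i : I} {k : K} {j : J'}
    (h : (symMul A B i k).map Prod.swap = symMul B' A' i k) {a : C} {b : D}
    (hb : b ∈ B' i j) (ha : a ∈ A' j k) : ∃ s, a ∈ A i s ∧ b ∈ B s k := by
  have hm : (b, a) ∈ (symMul A B i k).map Prod.swap := h ▸ mem_symMul.2 ⟨j, hb, ha⟩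
  obtain ⟨⟨a', b'⟩, hab, he⟩ := Multiset.mem_map.1 hm
  obtain ⟨rfl, rfl⟩ : b' = b ∧ a' = a := by simpa using he
  exact mem_symMul.1 hab

theorem length_of_mem_prodFrom {S : Type} {m : ℕ → ℕ}
    {M : ∀ l, Fin (m l) → Fin (m (l + 1)) → Multiset S} {n k : ℕ}
    {i : Fin (m n)} {j : Fin (m (n + k))} {w : List S}
    (h : w ∈ prodFrom M n k i j) : w.length = k := by
  induction k generalizing w with
  | zero =>
    simp only [prodFrom] at h
    split_ifs at h <;> simp_all
  | succ k ih =>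
    simp only [prodFrom, Multiset.mem_sum, Multiset.mem_bind, Multiset.mem_map] at h
    obtain ⟨p, -, v, hv, a, -, rfl⟩ := h
    simp [ih hv]

/-- A two-letter admissible word is read along two consecutive matrices. -/
theorem exists_of_pair_mem_smbWords {S : Type} {M : SMBData S S} {x y : S}
    (h : [x, y] ∈ smbWords M) :
    ∃ (n : ℕ) (i : Fin (M.m n)) (p : Fin (M.m (n + 1))) (j : Fin (M.m (n + 2))),
      x ∈ M.Mp n i p ∧ y ∈ M.Mp (n + 1) p j := by
  obtain ⟨-, n, k, i, j, h⟩ := h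
  obtain rfl : 2 = k := length_of_mem_prodFrom h
  simp only [prodFrom, Multiset.mem_sum, Multiset.mem_bind, Multiset.mem_map] at h
  obtain ⟨p, -, v, ⟨q, -, u, hu, a, ha, rfl⟩, b, hb, he⟩ := h
  obtain rfl := List.length_eq_zero_iff.1
    (length_of_mem_prodFrom (M := M.Mp) (k := 0) hu)
  obtain ⟨rfl, rfl⟩ : a = x ∧ b = y := by simpa using he
  exact ⟨n, q, p, j, ha, hb⟩

namespace PSSE1Data

variable {A B C D : Type} {M : SMBData A A} {N : SMBData B B}

theorem exists_mem_P_mem_Q (pd : PSSE1Data C D M N) {l : ℕ} {i : Fin (M.m l)}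
    {j : Fin (M.m (l + 1))} {x : A} (hx : x ∈ M.Mp l i j) :
    ∃ a, (pd.φ x).1 ∈ pd.P (2 * l) (Fin.cast (pd.hc l).symm i) a ∧
      (pd.φ x).2 ∈ pd.Q (2 * l + 1) a (Fin.cast (pd.hc (l + 1)).symm j) := by
  have h := Multiset.mem_map_of_mem pd.φ hx
  rw [pd.hMp] at h
  exact mem_symMul.1 h

theorem exists_mem_Xe (pd : PSSE1Data C D M N) (hM : IsSMB M) (l : ℕ) (i : Fin (M.m l)) :
    ∃ k e, e ∈ pd.Xe l (Fin.cast (pd.hc l).symm i) k := by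
  obtain ⟨j, hj⟩ := hM.row_m l i
  obtain ⟨x, hx⟩ := Multiset.exists_mem_of_ne_zero hj
  have h := Multiset.mem_map_of_mem (Prod.swap ∘ pd.φ) hx
  rw [pd.hMm] at h
  obtain ⟨k, hk, -⟩ := mem_symMul.1 h
  exact ⟨k, _, hk⟩

theorem exists_eq_of_mem (pd : PSSE1Data C D M N) {l : ℕ} {i : Fin (pd.d (2 * l))}
    {k : Fin (pd.c (2 * l + 1))} {j : Fin (pd.d (2 * l + 2))} {a : D} {b : C}
    (ha : a ∈ pd.Q (2 * l) i k) (hb : b ∈ pd.P (2 * l + 1) k j) : ∃ y, pd.ψ y = (a, b) := by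
  have h : (a, b) ∈ (N.Mp l (Fin.cast (pd.hd l) i) (Fin.cast (pd.hd (l + 1)) j)).map pd.ψ := by
    rw [pd.hNp]
    exact mem_symMul.2 ⟨k, ha, hb⟩
  obtain ⟨y, -, hy⟩ := Multiset.mem_map.1 h
  exact ⟨y, hy⟩

end PSSE1Data

/-- if `M`, `N` are FPCC symbolic matrix bisystems which are properly
strong shift equivalent in 1-step via specifications `φ : Σ_M → C·D`, `ψ : Σ_N → D·C`,
then for any two-letter admissible word `x₁x₂` of the presenting subshift of `M`,
writing `φ x_i = c_i d_i`, there is a unique symbol `y₀ ∈ Σ_N` with `ψ y₀ = d₁ c₂`. -/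
theorem stmt_11 {A B C D : Type} (M : SMBData A A) (N : SMBData B B)
    (hMs : IsSMB M) (hMf : M.FPCC) (hNs : IsSMB N) (hNf : N.FPCC)
    (pd : PSSE1Data C D M N) (x₁ x₂ : A) (hw : [x₁, x₂] ∈ smbWords M) :
    ∃! y₀ : B, pd.ψ y₀ = ((pd.φ x₁).2, (pd.φ x₂).1) := by
  obtain ⟨n, i, p, j, h₁, h₂⟩ := exists_of_pair_mem_smbWords hw
  obtain ⟨a, -, hd₁⟩ := pd.exists_mem_P_mem_Q h₁
  obtain ⟨b, hc₂, hd₂⟩ := pd.exists_mem_P_mem_Q h₂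
  obtain ⟨k, e, he⟩ := pd.exists_mem_Xe hMs (n + 2) j
  obtain ⟨r, hr, -⟩ := mem_symMul_of_map_swap (pd.hXQ (n + 1) b k) hd₂ he
  obtain ⟨s, hs, hc⟩ := mem_symMul_of_map_swap (pd.hXP (n + 1) _ r) hc₂ hr
  obtain ⟨t, -, hd⟩ := mem_symMul_of_map_swap (pd.hXQ n a s) hd₁ hs
  obtain ⟨y, hy⟩ := pd.exists_eq_of_mem (l := n + 1) hd hc
  exact ⟨y, hy, fun z hz => pd.ψ_inj (hz.trans hy.symm)⟩
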